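/- Suppose c : ℂ → ℝ≥0 is locally of the form φ|f|² with φ smooth positive and f holomorphic, c not identically zero, and suppose F is the singular metric on T_ℂ with −Θ(T_ℂ,F) = (√−1/2π)∂∂̄ log c. If there are constants ε, ε' > 0 and a closed positive (1,1)-current ω on ℂ with −Θ(T_ℂ,F) ≥ ε ω and ω ≥ ε' √−1 c(t) dt∧dt̄ (as currents), then one obtains the inequality ∂_t∂_{t̄} log c(t) ≥ 2π ε ε' c(t) in the sense of currents, which is impossible by the Ahlfors–Schwarz lemma; hence such c, ω, ε, ε' cannot all exist with c ≢ 0. -/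

import Mathlib

open MeasureTheory

/-- The Laplacian of a real-valued function on ℂ; note `∂_t ∂_{t̄} = (1/4)·Δ`. -/
noncomputable def lapC (φ : ℂ → ℝ) (t : ℂ) : ℝ :=
  fderiv ℝ (fun s => fderiv ℝ φ s 1) t 1 +
    fderiv ℝ (fun s => fderiv ℝ φ s Complex.I) t Complex.I

/-- A real test function on ℂ: smooth with compact support. -/
def IsTestFun (φ : ℂ → ℝ) : Prop := ContDiff ℝ (⊤ : ℕ∞) φ ∧ HasCompactSupport φ

open Filter Topology Metric

/-- The second derivative of a real function at a local maximum is nonpositive. -/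
lemma IsLocalMax.second_deriv_nonpos {k k' : ℝ → ℝ} {a m : ℝ} (hmax : IsLocalMax k a)
    (hk : ∀ᶠ x in 𝓝 a, HasDerivAt k (k' x) x) (hk' : HasDerivAt k' m a) : m ≤ 0 := by
  by_contra! hm
  have hd : deriv k =ᶠ[𝓝 a] k' := hk.mono fun x hx => hx.deriv
  have hdd : deriv (deriv k) a = m := by rw [hd.deriv_eq, hk'.deriv]
  have hmin : IsLocalMin k a := isLocalMin_of_deriv_deriv_pos (hdd ▸ hm)
    hmax.deriv_eq_zero hk.self_of_nhds.continuousAt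
  have hconst : k =ᶠ[𝓝 a] fun _ => k a := by
    filter_upwards [hmax, hmin] with x h₁ h₂ using le_antisymm h₁ h₂
  have hzero : deriv (deriv k) a = 0 := by
    rw [hconst.deriv.deriv_eq]
    simp
  linarith

lemma ContDiff.fderiv_apply_const {g : ℂ → ℝ} (hg : ContDiff ℝ (⊤ : ℕ∞) g) (v : ℂ) :
    ContDiff ℝ (⊤ : ℕ∞) (fun s => fderiv ℝ g s v) :=
  (hg.fderiv_right (m := (⊤ : ℕ∞)) (by simp)).clm_apply contDiff_const

/-- If `L (a + x v) + p x` has a local maximum at `x = 0`, then the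
second directional derivative of `L` is bounded by the opposite of that of `p`. -/
lemma fderiv_fderiv_add_nonpos_of_isLocalMax_line {L : ℂ → ℝ} (hL : ContDiff ℝ (⊤ : ℕ∞) L)
    (a v : ℂ) {p p' : ℝ → ℝ} {m : ℝ}
    (hp : ∀ᶠ x in 𝓝 (0 : ℝ), HasDerivAt p (p' x) x) (hp' : HasDerivAt p' m 0)
    (hmax : IsLocalMax (fun x : ℝ => L (a + x • v) + p x) 0) :
    fderiv ℝ (fun s => fderiv ℝ L s v) a v + m ≤ 0 := by
  have hline (x : ℝ) : HasDerivAt (fun x : ℝ => a + x • v) v x := by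
    simpa using ((hasDerivAt_id x).smul_const v).const_add a
  have hL' : ContDiff ℝ 1 (fun s => fderiv ℝ L s v) :=
    (hL.fderiv_apply_const v).of_le (by exact_mod_cast le_top)
  refine hmax.second_deriv_nonpos (k' := fun x => fderiv ℝ L (a + x • v) v + p' x) ?_ ?_
  · filter_upwards [hp] with x hx
    exact (((hL.differentiable (by simp)) (a + x • v)).hasFDerivAt.comp_hasDerivAt x
      (hline x)).add hx
  · have h := ((hL'.differentiable (by simp)) (a + (0 : ℝ) • v)).hasFDerivAt.comp_hasDerivAt 0
      (hline 0)
    simp only [zero_smul, add_zero] at h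
    exact h.add hp'

/-- Derivatives of `2 log (D - 2 b x - x²)`, the logarithm of the inverse Poincaré density along
a unit-speed line. -/
lemma hasDerivAt_two_mul_log_quadratic {D b : ℝ} (hD : 0 < D) :
    (∀ᶠ x in 𝓝 (0 : ℝ), HasDerivAt (fun x : ℝ => 2 * Real.log (D - 2 * b * x - x ^ 2))
      (2 * ((-(2 * b) - 2 * x) / (D - 2 * b * x - x ^ 2))) x) ∧
    HasDerivAt (fun x : ℝ => 2 * ((-(2 * b) - 2 * x) / (D - 2 * b * x - x ^ 2)))
      (-4 / D - 8 * b ^ 2 / D ^ 2) 0 := by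
  have hq (x : ℝ) : HasDerivAt (fun x : ℝ => D - 2 * b * x - x ^ 2) (-(2 * b) - 2 * x) x := by
    refine ((((hasDerivAt_id x).const_mul (2 * b)).const_sub D).sub
      (hasDerivAt_pow 2 x)).congr_deriv ?_
    simp
  have hpos : ∀ᶠ x in 𝓝 (0 : ℝ), 0 < D - 2 * b * x - x ^ 2 :=
    (hq 0).continuousAt.eventually (lt_mem_nhds (by simpa using hD))
  refine ⟨?_, ?_⟩
  · filter_upwards [hpos] with x hx
    exact ((hq x).log hx.ne').const_mul 2
  · have hn : HasDerivAt (fun x : ℝ => -(2 * b) - 2 * x) (-2) 0 := by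
      simpa using ((hasDerivAt_id (0 : ℝ)).const_mul 2).const_sub (-(2 * b))
    have h := (hn.div (hq 0) (by simpa using hD.ne')).const_mul 2
    refine h.congr_deriv ?_
    have := hD.ne'
    simp
    field_simp
    ring

/-- A maximum of `L + 2 log (R² - |t|²)` inside the disc of radius `R` bounds `lapC L` by the
Laplacian of the logarithm of the Poincaré density. -/
lemma lapC_le_of_isLocalMax {L : ℂ → ℝ} (hL : ContDiff ℝ (⊤ : ℕ∞) L) {R : ℝ} {a : ℂ}
    (ha : ‖a‖ < R)
    (hmax : IsLocalMax (fun t : ℂ => L t + 2 * Real.log (R ^ 2 - ‖t‖ ^ 2)) a) :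
    lapC L a ≤ 8 * R ^ 2 / (R ^ 2 - ‖a‖ ^ 2) ^ 2 := by
  have hD : 0 < R ^ 2 - ‖a‖ ^ 2 := by nlinarith [norm_nonneg a]
  have hsq : ‖a‖ ^ 2 = a.re ^ 2 + a.im ^ 2 := by
    rw [Complex.sq_norm, Complex.normSq_apply]; ring
  have key (v : ℂ) (b : ℝ) (hv : ∀ x : ℝ, ‖a + x • v‖ ^ 2 = ‖a‖ ^ 2 + 2 * b * x + x ^ 2) :
      fderiv ℝ (fun s => fderiv ℝ L s v) a v +
        (-4 / (R ^ 2 - ‖a‖ ^ 2) - 8 * b ^ 2 / (R ^ 2 - ‖a‖ ^ 2) ^ 2) ≤ 0 := by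
    obtain ⟨h₁, h₂⟩ := hasDerivAt_two_mul_log_quadratic (b := b) hD
    refine fderiv_fderiv_add_nonpos_of_isLocalMax_line hL a v h₁ h₂ ?_
    have hcont : ContinuousAt (fun x : ℝ => a + x • v) 0 := by fun_prop
    have h := IsLocalMax.comp_continuous (g := fun x : ℝ => a + x • v) (b := 0)
      (by simpa using hmax) hcont
    refine h.congr (Eventually.of_forall fun x => ?_)
    simp only [Function.comp_apply, hv]
    ring_nf
  have h₁ := key 1 a.re fun x => by
    simp only [Complex.sq_norm, Complex.normSq_apply]; simp; ring
  have h₂ := key Complex.I a.im fun x => by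
    simp only [Complex.sq_norm, Complex.normSq_apply]; simp; ring
  have hid : 8 * R ^ 2 / (R ^ 2 - ‖a‖ ^ 2) ^ 2 =
      8 / (R ^ 2 - ‖a‖ ^ 2) + 8 * (a.re ^ 2 + a.im ^ 2) / (R ^ 2 - ‖a‖ ^ 2) ^ 2 := by
    rw [← hsq]
    field_simp
    ring
  rw [hid, lapC, mul_add, add_div]
  have : (8 : ℝ) / (R ^ 2 - ‖a‖ ^ 2) = 4 / (R ^ 2 - ‖a‖ ^ 2) + 4 / (R ^ 2 - ‖a‖ ^ 2) := by ring
  simp only [neg_div] at h₁ h₂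
  linarith

/-- Double integration by parts in a fixed direction against a test function. -/
lemma integral_mul_fderiv_fderiv_comm {L ψ : ℂ → ℝ} (hL : ContDiff ℝ (⊤ : ℕ∞) L)
    (hψ : IsTestFun ψ) (v : ℂ) :
    ∫ t, L t * fderiv ℝ (fun s => fderiv ℝ ψ s v) t v =
      ∫ t, fderiv ℝ (fun s => fderiv ℝ L s v) t v * ψ t := by
  obtain ⟨hψ, hs⟩ := hψ
  have hdir {g : ℂ → ℝ} (hg : ContDiff ℝ (⊤ : ℕ∞) g) := hg.fderiv_apply_const v
  have hs₁ : HasCompactSupport (fun s => fderiv ℝ ψ s v) := hs.fderiv_apply ℝ v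
  have hs₂ : HasCompactSupport (fun t => fderiv ℝ (fun s => fderiv ℝ ψ s v) t v) :=
    hs₁.fderiv_apply ℝ v
  have hint {g h : ℂ → ℝ} (hg : ContDiff ℝ (⊤ : ℕ∞) g) (hh : ContDiff ℝ (⊤ : ℕ∞) h)
      (hc : HasCompactSupport h) : Integrable fun t => g t * h t :=
    (hg.continuous.mul hh.continuous).integrable_of_hasCompactSupport hc.mul_left
  have hdiff {g : ℂ → ℝ} (hg : ContDiff ℝ (⊤ : ℕ∞) g) (S : Set ℂ) :
      ∀ x ∈ S, DifferentiableAt ℝ g x := fun x _ => hg.differentiable (by simp) x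
  rw [integral_mul_fderiv_eq_neg_fderiv_mul_of_integrable (hint (hdir hL) (hdir hψ) hs₁)
      (hint hL (hdir (hdir hψ)) hs₂) (hint hL (hdir hψ) hs₁) (hdiff hL _) (hdiff (hdir hψ) _),
    integral_mul_fderiv_eq_neg_fderiv_mul_of_integrable (hint (hdir (hdir hL)) hψ hs)
      (hint (hdir hL) (hdir hψ) hs₁) (hint (hdir hL) hψ hs) (hdiff (hdir hL) _) (hdiff hψ _), neg_neg]

lemma ContDiff.lapC {g : ℂ → ℝ} (hg : ContDiff ℝ (⊤ : ℕ∞) g) :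
    ContDiff ℝ (⊤ : ℕ∞) (lapC g) :=
  ((hg.fderiv_apply_const 1).fderiv_apply_const 1).add
    ((hg.fderiv_apply_const Complex.I).fderiv_apply_const Complex.I)

/-- The Laplacian is symmetric when one of the functions is a test function. -/
lemma integral_mul_lapC {L ψ : ℂ → ℝ} (hL : ContDiff ℝ (⊤ : ℕ∞) L) (hψ : IsTestFun ψ) :
    ∫ t, L t * lapC ψ t = ∫ t, lapC L t * ψ t := by
  have hleft (v : ℂ) : Integrable fun t => L t * fderiv ℝ (fun s => fderiv ℝ ψ s v) t v :=
    (hL.continuous.mul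
      ((hψ.1.fderiv_apply_const v).fderiv_apply_const v).continuous).integrable_of_hasCompactSupport
      ((hψ.2.fderiv_apply ℝ v).fderiv_apply ℝ v).mul_left
  have hright (v : ℂ) : Integrable fun t => fderiv ℝ (fun s => fderiv ℝ L s v) t v * ψ t :=
    (((hL.fderiv_apply_const v).fderiv_apply_const v).continuous.mul
      hψ.1.continuous).integrable_of_hasCompactSupport
      hψ.2.mul_left
  simp only [lapC, mul_add, add_mul]
  rw [integral_add (hleft _) (hleft _), integral_add (hright _) (hright _),
    integral_mul_fderiv_fderiv_comm hL hψ, integral_mul_fderiv_fderiv_comm hL hψ]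

lemma lapC_eq_zero_of_notMem_tsupport {ψ : ℂ → ℝ} {t : ℂ} (ht : t ∉ tsupport ψ) :
    lapC ψ t = 0 := by
  have h (v : ℂ) : fderiv ℝ (fun s => fderiv ℝ ψ s v) t v = 0 := by
    have h₀ : ψ =ᶠ[𝓝 t] fun _ => 0 := notMem_tsupport_iff_eventuallyEq.mp ht
    have h₁ : (fun s => fderiv ℝ ψ s v) =ᶠ[𝓝 t] fun _ => 0 := by
      filter_upwards [h₀.fderiv (𝕜 := ℝ)] with s hs
      simp [hs]
    simp [h₁.fderiv_eq]
  simp [lapC, h]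

/-- A function smooth near a point agrees near that point with a globally smooth one. -/
lemma exists_contDiff_eventuallyEq {u : ℂ → ℝ} {a : ℂ} {U : Set ℂ} (hU : U ∈ 𝓝 a)
    (hu : ContDiffOn ℝ (⊤ : ℕ∞) u U) :
    ∃ L : ℂ → ℝ, ContDiff ℝ (⊤ : ℕ∞) L ∧ L =ᶠ[𝓝 a] u := by
  obtain ⟨r, hr, hrU⟩ := Metric.mem_nhds_iff.mp hU
  let χ : ContDiffBump a := ⟨r / 4, r / 2, by positivity, by linarith⟩
  refine ⟨fun t => χ t * u t, ?_, ?_⟩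
  · refine contDiff_iff_contDiffAt.mpr fun t => ?_
    by_cases ht : t ∈ tsupport fun t => χ t * u t
    swap
    · exact contDiffAt_const.congr_of_eventuallyEq (notMem_tsupport_iff_eventuallyEq.mp ht)
    have ht' : t ∈ closedBall a (r / 2) := by
      have := tsupport_mul_subset_left (f := χ) (g := u) ht
      rwa [χ.tsupport_eq] at this
    have htb : t ∈ ball a r := closedBall_subset_ball (by linarith) ht'
    exact χ.contDiff.contDiffAt.mul
      (hu.contDiffAt (mem_of_superset (isOpen_ball.mem_nhds htb) hrU))
  · filter_upwards [χ.eventuallyEq_one] with t ht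
    simp [ht]

/-- A distributional lower bound on the Laplacian of `u` holds pointwise where `u` is smooth. -/
lemma le_lapC_of_integral_le {u L c : ℂ → ℝ} {K : ℝ} (hc : Continuous c) {a : ℂ}
    (hL : ContDiff ℝ (⊤ : ℕ∞) L) (hLu : L =ᶠ[𝓝 a] u)
    (h : ∀ ψ : ℂ → ℝ, IsTestFun ψ → (∀ t, 0 ≤ ψ t) →
      K * ∫ t, c t * ψ t ≤ ∫ t, u t * lapC ψ t) :
    K * c a ≤ lapC L a := by
  by_contra! hlt
  have hcont : Continuous (lapC L) := hL.lapC.continuous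
  have hnear : ∀ᶠ t in 𝓝 a, L t = u t ∧ lapC L t < K * c t :=
    hLu.and (hcont.continuousAt.eventually_lt (by fun_prop) hlt)
  obtain ⟨r, hr, hrU⟩ := Metric.eventually_nhds_iff_ball.mp hnear
  let ψ : ContDiffBump a := ⟨r / 4, r / 2, by positivity, by linarith⟩
  have hψ : IsTestFun ψ := ⟨ψ.contDiff, ψ.hasCompactSupport⟩
  have hsub : tsupport ψ ⊆ ball a r := by
    rw [ψ.tsupport_eq]
    exact closedBall_subset_ball (by change r / 2 < r; linarith)
  have hle := h ψ hψ fun t => ψ.nonneg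
  have heq : ∫ t, u t * lapC ψ t = ∫ t, lapC L t * ψ t := by
    rw [← integral_mul_lapC hL hψ]
    refine integral_congr_ae (Eventually.of_forall fun t => ?_)
    by_cases ht : t ∈ tsupport ψ
    · simp [(hrU t (hsub ht)).1]
    · simp [lapC_eq_zero_of_notMem_tsupport ht]
  have hpos : 0 < ∫ t, (K * c t - lapC L t) * ψ t := by
    refine Continuous.integral_pos_of_hasCompactSupport_nonneg_nonzero (x := a)
      (by have := ψ.continuous; fun_prop) ψ.hasCompactSupport.mul_left (fun t => ?_) ?_
    · by_cases ht : t ∈ tsupport ψ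
      · exact mul_nonneg (sub_nonneg.mpr (hrU t (hsub ht)).2.le) ψ.nonneg
      · simp [image_eq_zero_of_notMem_tsupport ht]
    · have h₁ : ψ a = 1 := ψ.eventuallyEq_one.self_of_nhds
      simpa [h₁] using (sub_pos.mpr hlt).ne'
  have hint {g : ℂ → ℝ} (hg : Continuous g) : Integrable fun t => g t * ψ t :=
    (hg.mul ψ.continuous).integrable_of_hasCompactSupport ψ.hasCompactSupport.mul_left
  have hsplit : ∫ t, (K * c t - lapC L t) * ψ t =
      K * (∫ t, c t * ψ t) - ∫ t, lapC L t * ψ t := by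
    rw [← integral_const_mul, ← integral_sub ((hint hc).const_mul K) (hint hcont)]
    exact integral_congr_ae (Eventually.of_forall fun t => by ring)
  linarith

/-- The Ahlfors–Schwarz estimate on the disc of radius `R`. -/
lemma mul_sq_le_of_lapC_log_ge {c : ℂ → ℝ} {K R : ℝ} (hc : Continuous c) (hc0 : ∀ t, 0 ≤ c t)
    (hR : 0 < R)
    (h : ∀ a, 0 < c a → ∃ L : ℂ → ℝ, ContDiff ℝ (⊤ : ℕ∞) L ∧
      L =ᶠ[𝓝 a] (fun t => Real.log (c t)) ∧ K * c a ≤ lapC L a)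
    {t : ℂ} (ht : ‖t‖ < R) :
    K * (c t * (R ^ 2 - ‖t‖ ^ 2) ^ 2) ≤ 8 * R ^ 2 := by
  rcases le_or_gt K 0 with hK | hK
  · have : K * (c t * (R ^ 2 - ‖t‖ ^ 2) ^ 2) ≤ 0 :=
      mul_nonpos_of_nonpos_of_nonneg hK (mul_nonneg (hc0 t) (sq_nonneg _))
    nlinarith [sq_nonneg R]
  obtain ⟨a, haR, hamax⟩ := (isCompact_closedBall (0 : ℂ) R).exists_isMaxOn
    ⟨0, by simpa using hR.le⟩
    (f := fun t : ℂ => c t * (R ^ 2 - ‖t‖ ^ 2) ^ 2) (by fun_prop)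
  have hle (s : ℂ) (hs : ‖s‖ ≤ R) :
      c s * (R ^ 2 - ‖s‖ ^ 2) ^ 2 ≤ c a * (R ^ 2 - ‖a‖ ^ 2) ^ 2 := hamax (by simpa using hs)
  refine (mul_le_mul_of_nonneg_left (hle t ht.le) hK.le).trans ?_
  rcases (mul_nonneg (hc0 a) (sq_nonneg (R ^ 2 - ‖a‖ ^ 2))).eq_or_lt with h0 | h0
  · rw [← h0]
    nlinarith [sq_nonneg R]
  have hca : 0 < c a := (hc0 a).lt_of_ne' (left_ne_zero_of_mul h0.ne')
  have hD : R ^ 2 - ‖a‖ ^ 2 ≠ 0 := by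
    intro hz
    simp [hz] at h0
  have haR' : ‖a‖ < R := by
    refine lt_of_le_of_ne (by simpa using haR) fun he => hD ?_
    simp [he]
  obtain ⟨L, hL, hLc, hKL⟩ := h a hca
  have hmax : IsLocalMax (fun t : ℂ => L t + 2 * Real.log (R ^ 2 - ‖t‖ ^ 2)) a := by
    have hpos : ∀ᶠ s in 𝓝 a, 0 < c s := hc.continuousAt.eventually (lt_mem_nhds hca)
    have hball : ∀ᶠ s : ℂ in 𝓝 a, ‖s‖ < R :=
      continuous_norm.continuousAt.eventually (gt_mem_nhds haR')
    have hlog {s : ℂ} (hs : 0 < c s) (hsR : ‖s‖ < R) :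
        Real.log (c s) + 2 * Real.log (R ^ 2 - ‖s‖ ^ 2) =
          Real.log (c s * (R ^ 2 - ‖s‖ ^ 2) ^ 2) := by
      have : R ^ 2 - ‖s‖ ^ 2 ≠ 0 := by nlinarith [norm_nonneg s]
      rw [Real.log_mul hs.ne' (by positivity), Real.log_pow]
      simp
    filter_upwards [hpos, hball, hLc] with s hs hsR hLs
    rw [hLs, hLc.self_of_nhds, hlog hs hsR, hlog hca haR']
    have : R ^ 2 - ‖s‖ ^ 2 ≠ 0 := by nlinarith [norm_nonneg s]
    exact Real.log_le_log (by positivity) (hle s hsR.le)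
  have hfin := hKL.trans (lapC_le_of_isLocalMax hL haR' hmax)
  rw [le_div_iff₀ (by positivity)] at hfin
  linarith

/-- **Ahlfors–Schwarz lemma** on the plane. -/
lemma eq_zero_of_lapC_log_ge {c : ℂ → ℝ} {K : ℝ} (hK : 0 < K) (hc : Continuous c)
    (hc0 : ∀ t, 0 ≤ c t)
    (h : ∀ a, 0 < c a → ∃ L : ℂ → ℝ, ContDiff ℝ (⊤ : ℕ∞) L ∧
      L =ᶠ[𝓝 a] (fun t => Real.log (c t)) ∧ K * c a ≤ lapC L a) (t : ℂ) :
    c t = 0 := by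
  have hbound : ∀ᶠ R : ℝ in atTop, c t ≤ 32 / K * (R ^ 2)⁻¹ := by
    filter_upwards [eventually_gt_atTop (2 * ‖t‖), eventually_gt_atTop 0] with R hRt hR
    have h₁ := mul_sq_le_of_lapC_log_ge hc hc0 hR h (t := t) (by linarith [norm_nonneg t])
    have h₂ : R ^ 2 / 2 ≤ R ^ 2 - ‖t‖ ^ 2 := by nlinarith [norm_nonneg t]
    have h₃ : K * (c t * (R ^ 2 / 2) ^ 2) ≤ 8 * R ^ 2 :=
      le_trans (by have := hc0 t; gcongr) h₁
    rw [← div_eq_mul_inv, div_div, le_div_iff₀ (by positivity)]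
    have : (R ^ 2) * (c t * (K * R ^ 2)) ≤ R ^ 2 * 32 := by nlinarith
    exact le_of_mul_le_mul_left this (by positivity)
  have hlim : Tendsto (fun R : ℝ => 32 / K * (R ^ 2)⁻¹) atTop (𝓝 0) := by
    simpa using (tendsto_inv_atTop_zero.comp (tendsto_pow_atTop two_ne_zero)).const_mul (32 / K)
  exact le_antisymm (ge_of_tendsto hlim hbound) (hc0 t)

/-- A function locally of the form `φ |f|²` is smooth. -/
lemma contDiffAt_of_local_form {c : ℂ → ℝ} {a : ℂ}
    (hloc : ∃ U ∈ 𝓝 a, ∃ φ : ℂ → ℝ, ∃ f : ℂ → ℂ,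
      ContDiffOn ℝ (⊤ : ℕ∞) φ U ∧ (∀ t ∈ U, 0 < φ t) ∧ DifferentiableOn ℂ f U ∧
      ∀ t ∈ U, c t = φ t * ‖f t‖ ^ 2) :
    ContDiffAt ℝ (⊤ : ℕ∞) c a := by
  obtain ⟨U, hU, φ, f, hφ, -, hf, hcU⟩ := hloc
  have hfa : ContDiffAt ℝ (⊤ : ℕ∞) f a :=
    (hf.analyticAt hU).contDiffAt.restrict_scalars ℝ
  exact ((hφ.contDiffAt hU).mul (hfa.norm_sq ℝ)).congr_of_eventuallyEq
    (eventually_of_mem hU hcU)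


/- STATEMENT 13: Suppose c : ℂ → ℝ≥0 is locally of the form φ|f|² (φ smooth positive,
f holomorphic), c ≢ 0, and F is the singular metric on T_ℂ with
−Θ(T_ℂ,F) = (√−1/2π)∂∂̄ log c.  If there are ε, ε' > 0 and a closed positive (1,1)-current
ω on ℂ (modelled by its positive coefficient measure against √−1 dt∧dt̄/2, so that testing
√−1 c dt∧dt̄ against ψ gives 2∫cψ) with −Θ(T_ℂ,F) ≥ ε ω and ω ≥ ε' √−1 c dt∧dt̄, then
∂_t∂_{t̄} log c ≥ 2π ε ε' c as currents, which contradicts the Ahlfors–Schwarz lemma;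
hence such data cannot exist. -/
theorem stmt_13 (c : ℂ → ℝ) (hc0 : ∀ t, 0 ≤ c t)
    (hloc : ∀ t₀ : ℂ, ∃ U ∈ nhds t₀, ∃ φ : ℂ → ℝ, ∃ f : ℂ → ℂ,
      ContDiffOn ℝ (⊤ : ℕ∞) φ U ∧ (∀ t ∈ U, 0 < φ t) ∧ DifferentiableOn ℂ f U ∧
      ∀ t ∈ U, c t = φ t * ‖f t‖ ^ 2)
    (hne : ∃ t, c t ≠ 0)
    (ω : Measure ℂ) [IsLocallyFiniteMeasure ω]
    (ε ε' : ℝ) (hε : 0 < ε) (hε' : 0 < ε')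
    (hΘω : ∀ ψ : ℂ → ℝ, IsTestFun ψ → (∀ t, 0 ≤ ψ t) →
      ε * ∫ t : ℂ, ψ t ∂ω ≤ (1 / (4 * Real.pi)) * ∫ t : ℂ, Real.log (c t) * lapC ψ t)
    (hωc : ∀ ψ : ℂ → ℝ, IsTestFun ψ → (∀ t, 0 ≤ ψ t) →
      ε' * (2 * ∫ t : ℂ, c t * ψ t) ≤ ∫ t : ℂ, ψ t ∂ω) :
    False := by
  have hsmooth : ContDiff ℝ (⊤ : ℕ∞) c :=
    contDiff_iff_contDiffAt.mpr fun a => contDiffAt_of_local_form (hloc a)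
  obtain ⟨t, ht⟩ := hne
  refine ht (eq_zero_of_lapC_log_ge (K := 8 * Real.pi * ε * ε') (by positivity)
    hsmooth.continuous hc0 (fun a ha => ?_) t)
  have hpos : {s | 0 < c s} ∈ 𝓝 a := hsmooth.continuous.continuousAt.eventually (lt_mem_nhds ha)
  obtain ⟨L, hL, hLc⟩ := exists_contDiff_eventuallyEq hpos
    (hsmooth.contDiffOn.log fun s (hs : 0 < c s) => hs.ne')
  refine ⟨L, hL, hLc, le_lapC_of_integral_le hsmooth.continuous hL hLc fun ψ hψ hψ0 => ?_⟩
  have h := (mul_le_mul_of_nonneg_left (hωc ψ hψ hψ0) hε.le).trans (hΘω ψ hψ hψ0)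
  rw [one_div_mul_eq_div, le_div_iff₀ (by positivity)] at h
  linarith
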